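/- arXiv:2402.14026 — 3 statements merged into one kernel-verified Lean document; each statement's English description precedes it below -/
import Mathlib

section
/- Sequential random projection (main theorem). Let ε ∈ (0,1) and δ ∈ (0,1) be fixed, let (Ω, F, (F_t)_{t≥0}, P) be a filtered probability space, and let M and T be positive integers. Let z_0 ∈ ℝ^M be an F_0-measurable random vector with E[‖z_0‖²] = 1 and |‖z_0‖² − 1| ≤ ε/2 almost surely. Let (z_t)_{t≥1} ⊂ ℝ^M be a stochastic process adapted to (F_t)_{t≥1} such that ‖z_t‖ = 1 almost surely for every t ≥ 1 and such that it is conditionally √(c₀/M)-sub-Gaussian, i.e. for every fixed unit vector v ∈ S^{M−1}, every t ≥ 1 and every λ ∈ ℝ, E[exp(λ⟨v, z_t⟩) | F_{t−1}] ≤ exp(λ² c₀ / (2M)) almost surely. Let (x_t)_{t≥1} ⊂ ℝ be a process such that each x_t is F_{t−1}-measurable and x_t² ≤ c_x almost surely, where c₀ and c_x are absolute positive constants, and let x_0 ∈ ℝ be a fixed nonzero real number. If M ≥ (16 c₀ (1+ε)/ε²) · ( log(1/δ) + log(1 + c_x T / x₀²) ), then with probability at least 1 − δ, simultaneously for all t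 ∈ {0, 1, …, T}: (1 − ε) · Σ_{i=0}^{t} x_i² ≤ ‖Σ_{i=0}^{t} x_i z_i‖² ≤ (1 + ε) · Σ_{i=0}^{t} x_i². -/
open MeasureTheory Real
open scoped ENNReal RealInnerProductSpace

section
variable {Ω E : Type*} [NormedAddCommGroup E] [InnerProductSpace ℝ E]
  {m m0 : MeasurableSpace Ω} {μ : Measure Ω}

theorem setLIntegral_exp_inner_sub_le_of_condExp [IsFiniteMeasure μ] (hm : m ≤ m0) {z : Ω → E}
    (hz : StronglyMeasurable z) (hz_norm : ∀ᵐ ω ∂μ, ‖z ω‖ = 1) {c : ℝ}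
    (hsub : ∀ v : E, ‖v‖ = 1 → ∀ l : ℝ,
      μ[fun ω => exp (l * ⟪v, z ω⟫) | m] ≤ᵐ[μ] fun _ => exp (c * l ^ 2 / 2))
    (y : E) {s : Set Ω} (hs : MeasurableSet[m] s) :
    ∫⁻ ω in s, ENNReal.ofReal (exp (⟪y, z ω⟫ - c * ‖y‖ ^ 2 / 2)) ∂μ ≤ μ s := by
  rcases eq_or_ne y 0 with rfl | hy
  · simp
  have hy' : ‖y‖ ≠ 0 := norm_ne_zero_iff.2 hy
  have hint : Integrable (fun ω => exp (⟪y, z ω⟫)) μ := by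
    refine Integrable.of_bound (C := exp ‖y‖)
      (continuous_exp.comp_stronglyMeasurable
        (stronglyMeasurable_const.inner hz)).aestronglyMeasurable ?_
    filter_upwards [hz_norm] with ω hω
    rw [norm_of_nonneg (exp_pos _).le, exp_le_exp]
    simpa [hω] using real_inner_le_norm y (z ω)
  have hcond : μ[fun ω => exp (⟪y, z ω⟫) | m] ≤ᵐ[μ] fun _ => exp (c * ‖y‖ ^ 2 / 2) := by
    have h := hsub (‖y‖⁻¹ • y) (by rw [norm_smul, norm_inv, norm_norm, inv_mul_cancel₀ hy']) ‖y‖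
    simpa only [real_inner_smul_left, mul_inv_cancel_left₀ hy'] using h
  have hset : ∫ ω in s, exp (⟪y, z ω⟫) ∂μ ≤ μ.real s * exp (c * ‖y‖ ^ 2 / 2) := by
    rw [← setIntegral_condExp hm hint hs, ← smul_eq_mul, ← setIntegral_const]
    exact setIntegral_mono_ae integrable_condExp.integrableOn (integrable_const _).integrableOn
      hcond
  rw [← ofReal_integral_eq_lintegral_ofReal, ← ofReal_measureReal]
  · refine ENNReal.ofReal_le_ofReal ?_
    simp only [exp_sub, integral_div]
    rwa [div_le_iff₀ (exp_pos _)]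
  · simp only [exp_sub]
    exact (hint.div_const _).integrableOn
  · exact ae_of_all _ fun _ => (exp_pos _).le

theorem setLIntegral_exp_inner_sub_le (hm : m ≤ m0) {z : Ω → E} (hz : StronglyMeasurable z) {c : ℝ}
    (hconst : ∀ y : E, ∀ s, MeasurableSet[m] s →
      ∫⁻ ω in s, ENNReal.ofReal (exp (⟪y, z ω⟫ - c * ‖y‖ ^ 2 / 2)) ∂μ ≤ μ s)
    {u : Ω → E} (hu : StronglyMeasurable[m] u) {s : Set Ω} (hs : MeasurableSet[m] s) :
    ∫⁻ ω in s, ENNReal.ofReal (exp (⟪u ω, z ω⟫ - c * ‖u ω‖ ^ 2 / 2)) ∂μ ≤ μ s := by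
  have hmeas {w : Ω → E} (hw : StronglyMeasurable[m] w) :
      Measurable fun ω => ENNReal.ofReal (exp (⟪w ω, z ω⟫ - c * ‖w ω‖ ^ 2 / 2)) := by
    have h1 : StronglyMeasurable fun ω => ⟪w ω, z ω⟫ := (hw.mono hm).inner hz
    have h2 : StronglyMeasurable fun ω => ‖w ω‖ := (hw.mono hm).norm
    have h1 := h1.measurable
    have h2 := h2.measurable
    fun_prop
  have hsimple (w : @SimpleFunc Ω m E) :
      ∫⁻ ω in s, ENNReal.ofReal (exp (⟪w ω, z ω⟫ - c * ‖w ω‖ ^ 2 / 2)) ∂μ ≤ μ s := by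
    have hset (y : E) : MeasurableSet[m] (s ∩ w ⁻¹' {y}) :=
      hs.inter (@SimpleFunc.measurableSet_fiber Ω E m w y)
    have hdisj : Set.PairwiseDisjoint (↑(@SimpleFunc.range Ω E m w)) fun y => s ∩ w ⁻¹' {y} := by
      intro y _ y' _ hne
      refine Set.disjoint_left.2 fun ω h h' => hne ?_
      exact (h.2 : w ω = y).symm.trans h'.2
    have hunion : s = ⋃ y ∈ @SimpleFunc.range Ω E m w, s ∩ w ⁻¹' {y} := by
      ext ω
      simp only [Set.mem_iUnion, Set.mem_inter_iff, Set.mem_preimage, Set.mem_singleton_iff,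
        exists_prop]
      exact ⟨fun h => ⟨w ω, @SimpleFunc.mem_range_self Ω E m w ω, h, rfl⟩, fun ⟨_, _, h, _⟩ => h⟩
    conv_lhs => rw [hunion]
    conv_rhs => rw [hunion]
    rw [lintegral_biUnion_finset hdisj fun y _ => hm _ (hset y),
      measure_biUnion_finset hdisj fun y _ => hm _ (hset y)]
    refine Finset.sum_le_sum fun y _ => ?_
    refine (setLIntegral_congr_fun (hm _ (hset y)) fun ω hω => ?_).trans_le (hconst y _ (hset y))
    rw [show w ω = y from hω.2]
  calc ∫⁻ ω in s, ENNReal.ofReal (exp (⟪u ω, z ω⟫ - c * ‖u ω‖ ^ 2 / 2)) ∂μ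
      = ∫⁻ ω in s, Filter.liminf (fun n => ENNReal.ofReal
          (exp (⟪hu.approx n ω, z ω⟫ - c * ‖hu.approx n ω‖ ^ 2 / 2))) Filter.atTop ∂μ := by
        refine lintegral_congr fun ω => (Filter.Tendsto.liminf_eq ?_).symm
        refine (Continuous.tendsto (f := fun y : E =>
          ENNReal.ofReal (exp (⟪y, z ω⟫ - c * ‖y‖ ^ 2 / 2))) ?_ (u ω)).comp (hu.tendsto_approx ω)
        exact ENNReal.continuous_ofReal.comp (by fun_prop)
    _ ≤ Filter.liminf (fun n => ∫⁻ ω in s, ENNReal.ofReal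
          (exp (⟪hu.approx n ω, z ω⟫ - c * ‖hu.approx n ω‖ ^ 2 / 2)) ∂μ) Filter.atTop :=
        lintegral_liminf_le fun n => hmeas (hu.approx n).stronglyMeasurable
    _ ≤ Filter.liminf (fun _ : ℕ => μ s) Filter.atTop :=
        Filter.liminf_le_liminf (Filter.Eventually.of_forall fun n => hsimple _)
    _ = μ s := Filter.liminf_const _

theorem lintegral_mul_le_of_setLIntegral_le (hm : m ≤ m0) {f : Ω → ℝ≥0∞} (hf : Measurable f)
    (h : ∀ s, MeasurableSet[m] s → ∫⁻ ω in s, f ω ∂μ ≤ μ s)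
    {g : Ω → ℝ≥0∞} (hg : Measurable[m] g) :
    ∫⁻ ω, g ω * f ω ∂μ ≤ ∫⁻ ω, g ω ∂μ := by
  have hle : (μ.withDensity f).trim hm ≤ μ.trim hm := by
    refine Measure.le_iff.2 fun s hs => ?_
    rw [trim_measurableSet_eq hm hs, trim_measurableSet_eq hm hs, withDensity_apply _ (hm _ hs)]
    exact h s hs
  calc ∫⁻ ω, g ω * f ω ∂μ = ∫⁻ ω, g ω ∂(μ.withDensity f) := by
        rw [lintegral_withDensity_eq_lintegral_mul _ hf (hg.mono hm le_rfl)]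
        simp [mul_comm]
    _ = ∫⁻ ω, g ω ∂((μ.withDensity f).trim hm) := (lintegral_trim hm hg).symm
    _ ≤ ∫⁻ ω, g ω ∂(μ.trim hm) := lintegral_mono' hle le_rfl
    _ = ∫⁻ ω, g ω ∂μ := lintegral_trim hm hg

end

theorem lintegral_exp_mul_sub_sq (a : ℝ) {b : ℝ} (hb : 0 < b) :
    ∫⁻ l : ℝ, ENNReal.ofReal (exp (l * a - l ^ 2 * b / 2))
      = ENNReal.ofReal (√(2 * π / b) * exp (a ^ 2 / (2 * b))) := by
  have hv : b⁻¹.toNNReal ≠ 0 := (toNNReal_pos.2 (inv_pos.2 hb)).ne'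
  have key (l : ℝ) : ENNReal.ofReal (exp (l * a - l ^ 2 * b / 2))
      = ENNReal.ofReal (√(2 * π / b) * exp (a ^ 2 / (2 * b))) *
        ENNReal.ofReal (ProbabilityTheory.gaussianPDFReal (a / b)
          b⁻¹.toNNReal l) := by
    rw [← ENNReal.ofReal_mul (by positivity), ProbabilityTheory.gaussianPDFReal_def]
    congr 1
    have hs : √(2 * π / b) ≠ 0 := by positivity
    simp only [coe_toNNReal _ (inv_pos.2 hb).le]
    rw [← div_eq_mul_inv, mul_mul_mul_comm, mul_inv_cancel₀ hs, one_mul, ← exp_add]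
    congr 1
    field_simp
    ring
  simp_rw [key]
  rw [lintegral_const_mul _ (ProbabilityTheory.measurable_gaussianPDFReal _ _).ennreal_ofReal,
    ProbabilityTheory.lintegral_gaussianPDFReal_eq_one _ hv, mul_one]

/-- **Ville's inequality** over a finite horizon, for extended nonnegative processes. -/
theorem mul_measure_exists_le_le_lintegral {Ω : Type*} {m0 : MeasurableSpace Ω} {μ : Measure Ω}
    (ℱ : Filtration ℕ m0) {W : ℕ → Ω → ℝ≥0∞} (hW : ∀ t, Measurable[ℱ t] (W t))
    (hstep : ∀ t s, MeasurableSet[ℱ t] s → ∫⁻ ω in s, W (t + 1) ω ∂μ ≤ ∫⁻ ω in s, W t ω ∂μ)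
    (a : ℝ≥0∞) (T : ℕ) :
    a * μ {ω | ∃ t ≤ T, a ≤ W t ω} ≤ ∫⁻ ω, W 0 ω ∂μ := by
  have hlevel (t : ℕ) : MeasurableSet[ℱ t] {ω | a ≤ W t ω} := hW t measurableSet_Ici
  have hB (t : ℕ) : MeasurableSet[ℱ t] {ω | ∃ r ≤ t, a ≤ W r ω} := by
    have : {ω | ∃ r ≤ t, a ≤ W r ω} = ⋃ r ∈ Set.Iic t, {ω | a ≤ W r ω} := by
      ext; simp
    rw [this]
    exact MeasurableSet.biUnion (Set.to_countable _) fun r hr => ℱ.mono hr _ (hlevel r)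
  have hsplit (t : ℕ) {C : Set Ω} (hC : MeasurableSet C) :
      a * μ (C ∩ {ω | a ≤ W t ω}) + ∫⁻ ω in C \ {ω | a ≤ W t ω}, W t ω ∂μ
        ≤ ∫⁻ ω in C, W t ω ∂μ := by
    have hl := ℱ.le t _ (hlevel t)
    rw [← lintegral_inter_add_sdiff (W t) C hl]
    gcongr
    rw [← setLIntegral_const]
    exact setLIntegral_mono' (hC.inter hl) fun ω hω => hω.2
  have main (t : ℕ) : a * μ {ω | ∃ r ≤ t, a ≤ W r ω}
      + ∫⁻ ω in {ω | ∃ r ≤ t, a ≤ W r ω}ᶜ, W t ω ∂μ ≤ ∫⁻ ω, W 0 ω ∂μ := by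
    induction t with
    | zero =>
      have h := hsplit 0 MeasurableSet.univ
      simpa [Set.compl_eq_univ_sdiff] using h
    | succ t ih =>
      set B := {ω | ∃ r ≤ t, a ≤ W r ω}
      have hsucc : {ω | ∃ r ≤ t + 1, a ≤ W r ω} = B ∪ (Bᶜ ∩ {ω | a ≤ W (t + 1) ω}) := by
        ext ω
        simp only [B, Nat.le_add_one_iff, Set.mem_ofPred_eq, Set.mem_union, Set.mem_inter_iff,
          Set.mem_compl_iff, or_and_right, exists_or, exists_eq_left]
        by_cases h : ∃ r ≤ t, a ≤ W r ω <;> simp [h]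
      have hcompl : (B ∪ (Bᶜ ∩ {ω | a ≤ W (t + 1) ω}))ᶜ = Bᶜ \ {ω | a ≤ W (t + 1) ω} := by
        ext ω
        simp only [Set.mem_compl_iff, Set.mem_union, Set.mem_inter_iff, Set.mem_sdiff]
        tauto
      rw [hsucc, hcompl]
      calc _ ≤ a * (μ B + μ (Bᶜ ∩ {ω | a ≤ W (t + 1) ω}))
            + ∫⁻ ω in Bᶜ \ {ω | a ≤ W (t + 1) ω}, W (t + 1) ω ∂μ := by
            gcongr; exact measure_union_le _ _
        _ ≤ a * μ B + ∫⁻ ω in Bᶜ, W (t + 1) ω ∂μ := by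
            rw [mul_add, add_assoc]
            gcongr
            exact hsplit (t + 1) (ℱ.le t _ (hB t)).compl
        _ ≤ a * μ B + ∫⁻ ω in Bᶜ, W t ω ∂μ := by
            exact add_le_add_right (hstep t _ (hB t).compl) _
        _ ≤ _ := ih
  exact le_self_add.trans (main T)

theorem setLIntegral_lintegral_exp_add_le {Ω E : Type*} [NormedAddCommGroup E]
    [InnerProductSpace ℝ E] {m m0 : MeasurableSpace Ω} {μ : Measure Ω} [SFinite μ] (hm : m ≤ m0)
    {z : Ω → E} (hz : StronglyMeasurable z) {c : ℝ}
    (hconst : ∀ y : E, ∀ s, MeasurableSet[m] s →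
      ∫⁻ ω in s, ENNReal.ofReal (exp (⟪y, z ω⟫ - c * ‖y‖ ^ 2 / 2)) ∂μ ≤ μ s)
    {u : Ω → E} (hu : StronglyMeasurable[m] u) {N V V' : Ω → ℝ} (hN : Measurable[m] N)
    (hV : Measurable[m] V) (hV' : Measurable V') (hVV' : ∀ ω, c * ‖u ω‖ ^ 2 ≤ V' ω - V ω)
    {s : Set Ω} (hs : MeasurableSet[m] s) :
    ∫⁻ ω in s, (∫⁻ l : ℝ, ENNReal.ofReal (exp (l * (N ω + ⟪u ω, z ω⟫) - l ^ 2 * V' ω / 2))) ∂μ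
      ≤ ∫⁻ ω in s, (∫⁻ l : ℝ, ENNReal.ofReal (exp (l * N ω - l ^ 2 * V ω / 2))) ∂μ := by
  have hN0 := hN.mono hm le_rfl
  have hV0 := hV.mono hm le_rfl
  have hinner : Measurable fun ω => ⟪u ω, z ω⟫ := ((hu.mono hm).inner hz).measurable
  have hswap {f v : Ω → ℝ} (hf : Measurable f) (hv : Measurable v) :
      ∫⁻ ω in s, (∫⁻ l : ℝ, ENNReal.ofReal (exp (l * f ω - l ^ 2 * v ω / 2))) ∂μ
        = ∫⁻ l : ℝ, (∫⁻ ω in s, ENNReal.ofReal (exp (l * f ω - l ^ 2 * v ω / 2)) ∂μ) := by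
    refine lintegral_lintegral_swap (Measurable.aemeasurable ?_)
    unfold Function.uncurry
    fun_prop
  have hsum : Measurable fun ω => N ω + ⟪u ω, z ω⟫ := hN0.add hinner
  rw [hswap hsum hV', hswap hN0 hV0]
  refine lintegral_mono fun l => ?_
  have hlu : StronglyMeasurable[m] fun ω => l • u ω := hu.const_smul l
  have hmeas : Measurable fun ω =>
      ENNReal.ofReal (exp (⟪l • u ω, z ω⟫ - c * ‖l • u ω‖ ^ 2 / 2)) := by
    have h1 : Measurable fun ω => ⟪l • u ω, z ω⟫ := ((hlu.mono hm).inner hz).measurable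
    have h2 : Measurable fun ω => ‖l • u ω‖ := (hlu.mono hm).norm.measurable
    fun_prop
  have hgN : Measurable[m] fun ω => ENNReal.ofReal (exp (l * N ω - l ^ 2 * V ω / 2)) := by
    have : Measurable fun p : ℝ × ℝ => ENNReal.ofReal (exp (l * p.1 - l ^ 2 * p.2 / 2)) := by
      fun_prop
    exact this.comp (hN.prodMk hV)
  have hg := hgN.indicator hs
  have key := lintegral_mul_le_of_setLIntegral_le hm hmeas
    (fun r hr => setLIntegral_exp_inner_sub_le hm hz hconst hlu hr) hg
  rw [lintegral_indicator (hm _ hs)] at key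
  refine le_trans ?_ key
  rw [← lintegral_indicator (hm _ hs)]
  refine lintegral_mono fun ω => ?_
  by_cases hω : ω ∈ s
  · simp only [Set.indicator_of_mem hω]
    rw [← ENNReal.ofReal_mul (exp_pos _).le, ← exp_add]
    refine ENNReal.ofReal_le_ofReal (exp_le_exp.2 ?_)
    rw [real_inner_smul_left, norm_smul, mul_pow, norm_eq_abs, sq_abs]
    nlinarith [mul_le_mul_of_nonneg_left (hVV' ω) (sq_nonneg l)]
  · simp [Set.indicator_of_notMem hω]

section
variable {E : Type*} [NormedAddCommGroup E] [InnerProductSpace ℝ E]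

open scoped Classical in
/-- The direction whose inner product with `z (t + 1)` is the cross term in the expansion of
`‖∑ i ≤ t + 1, x i • z i‖ ^ 2`, set to zero once the norm exceeds its upper target at time `t`. -/
noncomputable def truncatedDirection (ε : ℝ) (x : ℕ → ℝ) (z : ℕ → E) (t : ℕ) : E :=
  if ‖∑ i ∈ Finset.range (t + 1), x i • z i‖ ^ 2
      ≤ (1 + ε) * ∑ i ∈ Finset.range (t + 1), x i ^ 2
  then (2 * x (t + 1)) • ∑ i ∈ Finset.range (t + 1), x i • z i else 0

/-- The sum of the truncated cross terms up to time `t`. -/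
noncomputable def truncatedCrossSum (ε : ℝ) (x : ℕ → ℝ) (z : ℕ → E) (t : ℕ) : ℝ :=
  ∑ i ∈ Finset.range t, ⟪truncatedDirection ε x z i, z (i + 1)⟫

theorem mul_norm_truncatedDirection_sq_le {ε c : ℝ} (hε : 0 ≤ ε) (hc : 0 ≤ c)
    (x : ℕ → ℝ) (z : ℕ → E) (t : ℕ) :
    c * ‖truncatedDirection ε x z t‖ ^ 2
      ≤ 2 * c * (1 + ε) * (∑ i ∈ Finset.range (t + 2), x i ^ 2) ^ 2
        - 2 * c * (1 + ε) * (∑ i ∈ Finset.range (t + 1), x i ^ 2) ^ 2 := by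
  have hS : 0 ≤ ∑ i ∈ Finset.range (t + 1), x i ^ 2 := Finset.sum_nonneg fun i _ => sq_nonneg _
  rw [Finset.sum_range_succ _ (t + 1), truncatedDirection]
  set S := ∑ i ∈ Finset.range (t + 1), x i ^ 2
  have hq : 0 ≤ 2 * c * (1 + ε) := by positivity
  split_ifs with h
  · rw [norm_smul, mul_pow, norm_eq_abs, sq_abs]
    have h1 : c * ((2 * x (t + 1)) ^ 2 * ‖∑ i ∈ Finset.range (t + 1), x i • z i‖ ^ 2)
        ≤ c * ((2 * x (t + 1)) ^ 2 * ((1 + ε) * S)) := by gcongr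
    have h2 : 0 ≤ 2 * c * (1 + ε) * x (t + 1) ^ 4 := by positivity
    nlinarith
  · have : 0 ≤ 2 * c * (1 + ε) * (2 * S * x (t + 1) ^ 2 + x (t + 1) ^ 4) := by positivity
    simp only [norm_zero]
    nlinarith

theorem abs_norm_sum_smul_sq_sub_le {ε : ℝ} {x : ℕ → ℝ} {z : ℕ → E} {T : ℕ}
    (hz0 : |‖z 0‖ ^ 2 - 1| ≤ ε / 2) (hz : ∀ t, 1 ≤ t → ‖z t‖ = 1)
    (hN : ∀ t ≤ T, |truncatedCrossSum ε x z t|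
      ≤ ε / 2 * ∑ i ∈ Finset.range (t + 1), x i ^ 2) {t : ℕ} (ht : t ≤ T) :
    |‖∑ i ∈ Finset.range (t + 1), x i • z i‖ ^ 2 - ∑ i ∈ Finset.range (t + 1), x i ^ 2|
      ≤ ε * ∑ i ∈ Finset.range (t + 1), x i ^ 2 := by
  have hε : 0 ≤ ε / 2 := (abs_nonneg _).trans hz0
  have bound (t : ℕ) (ht : t ≤ T)
      (h : ‖∑ i ∈ Finset.range (t + 1), x i • z i‖ ^ 2 - ∑ i ∈ Finset.range (t + 1), x i ^ 2
        = x 0 ^ 2 * (‖z 0‖ ^ 2 - 1) + truncatedCrossSum ε x z t) :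
      |‖∑ i ∈ Finset.range (t + 1), x i • z i‖ ^ 2 - ∑ i ∈ Finset.range (t + 1), x i ^ 2|
        ≤ ε * ∑ i ∈ Finset.range (t + 1), x i ^ 2 := by
    have h0 : x 0 ^ 2 ≤ ∑ i ∈ Finset.range (t + 1), x i ^ 2 :=
      Finset.single_le_sum (f := fun i => x i ^ 2) (fun i _ => sq_nonneg _) (by simp)
    rw [h]
    calc |x 0 ^ 2 * (‖z 0‖ ^ 2 - 1) + truncatedCrossSum ε x z t|
        ≤ x 0 ^ 2 * |‖z 0‖ ^ 2 - 1| + |truncatedCrossSum ε x z t| := by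
          refine (abs_add_le _ _).trans_eq ?_
          rw [abs_mul, abs_of_nonneg (sq_nonneg (x 0))]
      _ ≤ (∑ i ∈ Finset.range (t + 1), x i ^ 2) * (ε / 2)
          + ε / 2 * ∑ i ∈ Finset.range (t + 1), x i ^ 2 := by
          gcongr
          exact hN t ht
      _ = _ := by ring
  refine bound t ht ?_
  induction t with
  | zero =>
    simp [truncatedCrossSum, norm_smul, mul_pow]
    ring
  | succ t ih =>
    have hb := bound t (by omega) (ih (by omega))
    have hdir : truncatedDirection ε x z t
        = (2 * x (t + 1)) • ∑ i ∈ Finset.range (t + 1), x i • z i :=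
      if_pos (by linarith [(abs_le.1 hb).2])
    rw [truncatedCrossSum, Finset.sum_range_succ _ t, ← truncatedCrossSum, hdir,
      Finset.sum_range_succ _ (t + 1), Finset.sum_range_succ _ (t + 1), norm_add_sq_real,
      norm_smul, hz (t + 1) (by omega), real_inner_smul_left, real_inner_smul_right, mul_one,
      norm_eq_abs, sq_abs]
    linarith [ih (by omega)]

end

theorem sq_le_of_sqrt_mul_exp_lt {q s S n ε δ R : ℝ} (hq : 0 < q) (hs : 0 < s) (hS : 0 < S)
    (hR : 0 < R) (hSR : S ≤ s * R) (hδ : 0 < δ) (hlog : 8 * q * log (R / δ) ≤ ε ^ 2)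
    (h : √(2 * π / (q * S ^ 2)) * exp (n ^ 2 / (2 * (q * S ^ 2))) < √(2 * π / (q * s ^ 2)) / δ) :
    n ^ 2 ≤ (ε / 2 * S) ^ 2 := by
  by_contra! hn
  have hsqrt {r : ℝ} (hr : 0 < r) : √(2 * π / (q * r ^ 2)) = √(2 * π / q) / r := by
    rw [← div_div, sqrt_div (by positivity), sqrt_sq hr.le]
  have hexp : R / δ ≤ exp (n ^ 2 / (2 * (q * S ^ 2))) := by
    rw [← log_le_iff_le_exp (by positivity), le_div_iff₀ (by positivity)]
    nlinarith [mul_le_mul_of_nonneg_right hlog (sq_nonneg S)]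
  rw [hsqrt hS, hsqrt hs] at h
  refine h.not_ge ?_
  calc √(2 * π / q) / s / δ = √(2 * π / q) * (s * R)⁻¹ * (R / δ) := by field_simp
    _ ≤ √(2 * π / q) * S⁻¹ * exp (n ^ 2 / (2 * (q * S ^ 2))) := by gcongr
    _ = _ := by rw [← div_eq_mul_inv (√_)]

/-- Sequential random projection (main theorem): a martingale extension of the
Johnson–Lindenstrauss lemma for adaptively generated data. -/
theorem sequential_random_projection
    {Ω : Type*} {m0 : MeasurableSpace Ω} {μ : Measure Ω} [IsProbabilityMeasure μ]
    (ℱ : Filtration ℕ m0) (M T : ℕ) (hM : 0 < M) (hT : 0 < T)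
    (ε δ c₀ c_x : ℝ) (hε : ε ∈ Set.Ioo (0 : ℝ) 1) (hδ : δ ∈ Set.Ioo (0 : ℝ) 1)
    (hc₀ : 0 < c₀) (hcx : 0 < c_x)
    (z : ℕ → Ω → EuclideanSpace ℝ (Fin M))
    (hz0_meas : StronglyMeasurable[ℱ 0] (z 0))
    (hz0_mean : ∫ ω, ‖z 0 ω‖ ^ 2 ∂μ = 1)
    (hz0_dev : ∀ᵐ ω ∂μ, |‖z 0 ω‖ ^ 2 - 1| ≤ ε / 2)
    (hz_adapted : ∀ t, 1 ≤ t → StronglyMeasurable[ℱ t] (z t))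
    (hz_norm : ∀ t, 1 ≤ t → ∀ᵐ ω ∂μ, ‖z t ω‖ = 1)
    (hz_subG : ∀ v : EuclideanSpace ℝ (Fin M), ‖v‖ = 1 → ∀ t, 1 ≤ t → ∀ l : ℝ,
      μ[fun ω => Real.exp (l * ⟪v, z t ω⟫) | ℱ (t - 1)]
        ≤ᵐ[μ] fun _ => Real.exp (l ^ 2 * c₀ / (2 * M)))
    (x : ℕ → Ω → ℝ) (x₀ : ℝ) (hx₀ : x₀ ≠ 0) (hx0 : ∀ ω, x 0 ω = x₀)
    (hx_meas : ∀ t, 1 ≤ t → StronglyMeasurable[ℱ (t - 1)] (x t))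
    (hx_bdd : ∀ t, 1 ≤ t → ∀ᵐ ω ∂μ, (x t ω) ^ 2 ≤ c_x)
    (hMge : (M : ℝ) ≥ 16 * c₀ * (1 + ε) / ε ^ 2 *
      (Real.log (1 / δ) + Real.log (1 + c_x * T / x₀ ^ 2))) :
    μ {ω | ∀ t, t ≤ T →
        (1 - ε) * (∑ i ∈ Finset.range (t + 1), (x i ω) ^ 2)
            ≤ ‖∑ i ∈ Finset.range (t + 1), x i ω • z i ω‖ ^ 2
          ∧ ‖∑ i ∈ Finset.range (t + 1), x i ω • z i ω‖ ^ 2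
            ≤ (1 + ε) * (∑ i ∈ Finset.range (t + 1), (x i ω) ^ 2)}
      ≥ ENNReal.ofReal (1 - δ) := by
  obtain ⟨hε0, -⟩ := hε
  obtain ⟨hδ0, -⟩ := hδ
  have hM0 : (0 : ℝ) < M := Nat.cast_pos.2 hM
  have hT0 : (0 : ℝ) < T := Nat.cast_pos.2 hT
  have hx₀2 : 0 < x₀ ^ 2 := by positivity
  set R : ℝ := 1 + c_x * T / x₀ ^ 2 with hR
  have hR0 : 0 < R := by positivity
  set c : ℝ := c₀ / M with hc
  have hc0 : 0 < c := by positivity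
  set q : ℝ := 2 * c * (1 + ε) with hq
  have hq0 : 0 < q := by positivity
  have hlog : 8 * q * log (R / δ) ≤ ε ^ 2 := by
    rw [ge_iff_le, ← log_mul (by positivity) hR0.ne', one_div_mul_eq_div, div_mul_eq_mul_div,
      div_le_iff₀ (by positivity)] at hMge
    rw [hq, hc, show 8 * (2 * (c₀ / M) * (1 + ε)) * log (R / δ)
      = 16 * c₀ * (1 + ε) * log (R / δ) / M by ring, div_le_iff₀ hM0]
    linarith
  let Y : ℕ → Ω → EuclideanSpace ℝ (Fin M) := fun t ω => ∑ i ∈ Finset.range (t + 1), x i ω • z i ω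
  let S : ℕ → Ω → ℝ := fun t ω => ∑ i ∈ Finset.range (t + 1), x i ω ^ 2
  let u : ℕ → Ω → EuclideanSpace ℝ (Fin M) :=
    fun t ω => truncatedDirection ε (fun i => x i ω) (fun i => z i ω) t
  let N : ℕ → Ω → ℝ := fun t ω => truncatedCrossSum ε (fun i => x i ω) (fun i => z i ω) t
  have hx (t : ℕ) : StronglyMeasurable[ℱ (t - 1)] (x t) := by
    rcases Nat.eq_zero_or_pos t with rfl | ht
    · rw [show x 0 = fun _ => x₀ from funext hx0]
      exact stronglyMeasurable_const
    · exact hx_meas t ht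
  have hz (t : ℕ) : StronglyMeasurable[ℱ t] (z t) := by
    rcases Nat.eq_zero_or_pos t with rfl | ht
    · exact hz0_meas
    · exact hz_adapted t ht
  have hY (t : ℕ) : StronglyMeasurable[ℱ t] (Y t) :=
    Finset.stronglyMeasurable_fun_sum _ fun i hi => by
      have hi : i ≤ t := Nat.lt_succ_iff.1 (Finset.mem_range.1 hi)
      exact ((hx i).mono (ℱ.mono (by omega))).smul ((hz i).mono (ℱ.mono hi))
  have hS_pred (t : ℕ) : Measurable[ℱ (t - 1)] (S t) :=
    Finset.measurable_fun_sum _ fun i hi => by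
      have hi : i ≤ t := Nat.lt_succ_iff.1 (Finset.mem_range.1 hi)
      exact ((hx i).measurable.mono (ℱ.mono (by omega)) le_rfl).pow_const 2
  have hS (t : ℕ) : Measurable[ℱ t] (S t) := (hS_pred t).mono (ℱ.mono (by omega)) le_rfl
  have hu (t : ℕ) : StronglyMeasurable[ℱ t] (u t) := by
    have hset : MeasurableSet[ℱ t] {ω | ‖Y t ω‖ ^ 2 ≤ (1 + ε) * S t ω} :=
      measurableSet_le ((hY t).norm.measurable.pow_const 2) ((hS t).const_mul (1 + ε))
    exact StronglyMeasurable.ite hset (((hx (t + 1)).const_mul 2).smul (hY t))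
      stronglyMeasurable_const
  have hN (t : ℕ) : Measurable[ℱ t] (N t) :=
    Finset.measurable_fun_sum _ fun i hi => by
      have hi : i + 1 ≤ t := Finset.mem_range.1 hi
      exact (((hu i).mono (ℱ.mono (by omega))).inner ((hz (i + 1)).mono (ℱ.mono hi))).measurable
  have hS_pos (t : ℕ) (ω : Ω) : 0 < S t ω := by
    refine hx₀2.trans_le ?_
    rw [← hx0 ω]
    exact Finset.single_le_sum (f := fun i => x i ω ^ 2) (fun i _ => sq_nonneg _) (by simp)
  let W : ℕ → Ω → ℝ≥0∞ := fun t ω =>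
    ∫⁻ l : ℝ, ENNReal.ofReal (exp (l * N t ω - l ^ 2 * (q * S t ω ^ 2) / 2))
  have hW_eq (t : ℕ) (ω : Ω) : W t ω = ENNReal.ofReal
      (√(2 * π / (q * S t ω ^ 2)) * exp (N t ω ^ 2 / (2 * (q * S t ω ^ 2)))) := by
    have := hS_pos t ω
    exact lintegral_exp_mul_sub_sq _ (by positivity)
  have hW_meas (t : ℕ) : Measurable[ℱ t] (W t) := by
    have h : Measurable fun p : ℝ × ℝ => ENNReal.ofReal
      (√(2 * π / (q * p.2 ^ 2)) * exp (p.1 ^ 2 / (2 * (q * p.2 ^ 2)))) := by fun_prop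
    have h' := h.comp ((hN t).prodMk (hS t))
    simp only [Function.comp_def, ← hW_eq] at h'
    exact h'
  have hW_step (t : ℕ) (s : Set Ω) (hs : MeasurableSet[ℱ t] s) :
      ∫⁻ ω in s, W (t + 1) ω ∂μ ≤ ∫⁻ ω in s, W t ω ∂μ := by
    have hN_succ (ω : Ω) : N (t + 1) ω = N t ω + ⟪u t ω, z (t + 1) ω⟫ :=
      Finset.sum_range_succ _ t
    simp only [W, hN_succ]
    refine setLIntegral_lintegral_exp_add_le (c := c) (ℱ.le t) ((hz (t + 1)).mono (ℱ.le _)) ?_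
      (hu t) (hN t) (((hS t).pow_const 2).const_mul q)
      ((((hS (t + 1)).mono (ℱ.le _) le_rfl).pow_const 2).const_mul q)
      (fun ω => mul_norm_truncatedDirection_sq_le hε0.le hc0.le _ _ t) hs
    intro y r hr
    refine setLIntegral_exp_inner_sub_le_of_condExp (ℱ.le t) ((hz (t + 1)).mono (ℱ.le _))
      (hz_norm (t + 1) (by omega)) (fun v hv l => ?_) y hr
    have h := hz_subG v hv (t + 1) (by omega) l
    rwa [Nat.add_sub_cancel, show l ^ 2 * c₀ / (2 * M) = c * l ^ 2 / 2 by rw [hc]; ring] at h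
  set w : ℝ := √(2 * π / (q * (x₀ ^ 2) ^ 2)) with hw
  have hw0 : 0 < w := by positivity
  have hW0 (ω : Ω) : W 0 ω = ENNReal.ofReal w := by
    rw [hW_eq]
    simp [S, N, truncatedCrossSum, hx0, hw]
  set B : Set Ω := {ω | ∃ t ≤ T, ENNReal.ofReal (w / δ) ≤ W t ω}
  have hB_meas : MeasurableSet B := by
    have : B = ⋃ t ∈ Set.Iic T, {ω | ENNReal.ofReal (w / δ) ≤ W t ω} := by
      ext; simp [B]
    rw [this]
    exact MeasurableSet.biUnion (Set.to_countable _) fun t _ =>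
      ℱ.le t _ (hW_meas t measurableSet_Ici)
  have hB : μ B ≤ ENNReal.ofReal δ := by
    have h := mul_measure_exists_le_le_lintegral ℱ hW_meas hW_step (ENNReal.ofReal (w / δ)) T
    simp only [hW0, lintegral_const, measure_univ, mul_one] at h
    rw [mul_comm, ← ENNReal.le_div_iff_mul_le (by simp [hw0, hδ0]) (by simp),
      ← ENNReal.ofReal_div_of_pos (by positivity), div_div_cancel₀ hw0.ne'] at h
    exact h
  have hgood : ∀ᵐ ω ∂μ, ω ∈ Bᶜ → ∀ t, t ≤ T →
      (1 - ε) * S t ω ≤ ‖Y t ω‖ ^ 2 ∧ ‖Y t ω‖ ^ 2 ≤ (1 + ε) * S t ω := by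
    have hz_norm' : ∀ᵐ ω ∂μ, ∀ t, 1 ≤ t → ‖z t ω‖ = 1 :=
      ae_all_iff.2 fun t => ae_all_iff.2 (hz_norm t)
    have hx_bdd' : ∀ᵐ ω ∂μ, ∀ t, 1 ≤ t → x t ω ^ 2 ≤ c_x :=
      ae_all_iff.2 fun t => ae_all_iff.2 (hx_bdd t)
    filter_upwards [hz0_dev, hz_norm', hx_bdd'] with ω h0 h1 hxb hω
    have hN_le (t : ℕ) (ht : t ≤ T) : |N t ω| ≤ ε / 2 * S t ω := by
      have hlt : W t ω < ENNReal.ofReal (w / δ) := not_le.1 fun h => hω ⟨t, ht, h⟩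
      rw [hW_eq, ENNReal.ofReal_lt_ofReal_iff (by positivity)] at hlt
      refine abs_le_of_sq_le_sq (sq_le_of_sqrt_mul_exp_lt hq0 hx₀2 (hS_pos t ω) hR0 ?_ hδ0 hlog hlt)
        (mul_nonneg (by positivity) (hS_pos t ω).le)
      calc S t ω = (∑ i ∈ Finset.range t, x (i + 1) ω ^ 2) + x₀ ^ 2 := by
            rw [← hx0 ω]
            exact Finset.sum_range_succ' _ t
        _ ≤ (∑ _i ∈ Finset.range t, c_x) + x₀ ^ 2 := by
            gcongr with i
            exact hxb (i + 1) (by omega)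
        _ ≤ T * c_x + x₀ ^ 2 := by
            rw [Finset.sum_const, Finset.card_range, nsmul_eq_mul]
            gcongr
        _ = x₀ ^ 2 * R := by
            rw [hR]
            field_simp
            ring
    intro t ht
    have h := abs_le.1 (abs_norm_sum_smul_sq_sub_le h0 h1 hN_le ht)
    constructor
    · linarith [h.1]
    · linarith [h.2]
  calc ENNReal.ofReal (1 - δ) = 1 - ENNReal.ofReal δ := by
        rw [ENNReal.ofReal_sub _ hδ0.le, ENNReal.ofReal_one]
    _ ≤ 1 - μ B := tsub_le_tsub_left hB _
    _ = μ Bᶜ := (prob_compl_eq_one_sub hB_meas).symm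
    _ ≤ _ := measure_mono_ae hgood
end

section
/- Distribution of the inner product of a uniform point on the sphere with a fixed direction. Let n ≥ 2, let u ∈ ℝⁿ be a fixed unit vector, and let v be a random vector with the uniform (normalized surface) distribution on the unit sphere S^{n−1} ⊂ ℝⁿ. Then the law of ⟨u, v⟩ equals the pushforward of the Beta((n−1)/2, (n−1)/2) distribution under the map x ↦ 2x − 1; that is, ⟨u, v⟩ is distributed as 2·Beta((n−1)/2,(n−1)/2) − 1. -/
open MeasureTheory Real
open scoped RealInnerProductSpace

/-- The density of the Beta(a, b) distribution on `(0,1)`: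
`x^(a-1) (1-x)^(b-1) / B(a,b)` where `B(a,b) = Γ(a)Γ(b)/Γ(a+b)`. -/
noncomputable def betaPDFReal (a b x : ℝ) : ℝ :=
  if 0 < x ∧ x < 1 then
    (Real.Gamma (a + b) / (Real.Gamma a * Real.Gamma b)) * x ^ (a - 1) * (1 - x) ^ (b - 1)
  else 0

/-- The Beta(a, b) distribution on ℝ. -/
noncomputable def betaMeasure (a b : ℝ) : Measure ℝ :=
  volume.withDensity (fun x => ENNReal.ofReal (betaPDFReal a b x))

section

open Set Metric Module
open scoped ENNReal

/-- Polar coordinates for the lower Lebesgue integral of a radial function. -/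
theorem lintegral_fun_norm_addHaar {E : Type*} [NormedAddCommGroup E] [NormedSpace ℝ E]
    [MeasurableSpace E] [BorelSpace E] [FiniteDimensional ℝ E] [Nontrivial E]
    (μ : Measure E) [μ.IsAddHaarMeasure] {f : ℝ → ℝ≥0∞} (hf : Measurable f) :
    ∫⁻ x, f ‖x‖ ∂μ =
      μ.toSphere univ * ∫⁻ r in Ioi (0 : ℝ), ENNReal.ofReal (r ^ (finrank ℝ E - 1)) * f r := by
  calc
    ∫⁻ x, f ‖x‖ ∂μ = ∫⁻ x : ({(0)}ᶜ : Set E), f ‖x.1‖ ∂(μ.comap (↑)) := by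
      rw [lintegral_subtype_comap (measurableSet_singleton _).compl fun x ↦ f ‖x‖,
        restrict_compl_singleton]
    _ = ∫⁻ x, f x.2 ∂μ.toSphere.prod (.volumeIoiPow (finrank ℝ E - 1)) := by
      simpa using μ.measurePreserving_homeomorphUnitSphereProd.lintegral_comp_emb
        (Homeomorph.measurableEmbedding _) (f ∘ Subtype.val ∘ Prod.snd)
    _ = μ.toSphere univ * ∫⁻ x : Ioi (0 : ℝ), f x ∂.volumeIoiPow (finrank ℝ E - 1) := by
      rw [lintegral_prod _ (by fun_prop)]
      simp [mul_comm]
    _ = _ := by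
      rw [Measure.volumeIoiPow, lintegral_withDensity_eq_lintegral_mul _ (by fun_prop)
        (by fun_prop)]
      simp only [Pi.mul_apply]
      rw [lintegral_subtype_comap measurableSet_Ioi
        fun r : ℝ ↦ ENNReal.ofReal (r ^ (finrank ℝ E - 1)) * f r]

/-- Every unit vector is the image of the first coordinate vector under a linear isometry from an
orthogonal sum of a line with a space of codimension one. -/
theorem exists_linearIsometryEquiv_prod_apply_eq {E F : Type*}
    [NormedAddCommGroup E] [InnerProductSpace ℝ E] [FiniteDimensional ℝ E]
    [NormedAddCommGroup F] [InnerProductSpace ℝ F] [FiniteDimensional ℝ F]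
    (h : finrank ℝ E = finrank ℝ F + 1) {w : E} (hw : ‖w‖ = 1) :
    ∃ T : WithLp 2 (ℝ × F) ≃ₗᵢ[ℝ] E, T (WithLp.toLp 2 (1, 0)) = w := by
  have hd : finrank ℝ (WithLp 2 (ℝ × F)) = finrank ℝ E := by
    rw [(WithLp.linearEquiv 2 ℝ (ℝ × F)).finrank_eq, finrank_prod, h, finrank_self, add_comm]
  let T := (stdOrthonormalBasis ℝ (WithLp 2 (ℝ × F))).equiv (stdOrthonormalBasis ℝ E)
    (finCongr hd)
  have hT : ‖T (WithLp.toLp 2 (1, 0))‖ = ‖w‖ := by simp [hw]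
  exact ⟨T.trans (ℝ ∙ (T (WithLp.toLp 2 (1, 0)) - w))ᗮ.reflection, by
    simpa using Submodule.reflection_sub hT⟩

/-- Integrals of functions of the norm and of one coordinate, in a splitting of the space along
that coordinate. -/
theorem lintegral_inner_norm_eq_lintegral_prod {E F : Type*}
    [NormedAddCommGroup E] [InnerProductSpace ℝ E] [FiniteDimensional ℝ E]
    [MeasurableSpace E] [BorelSpace E]
    [NormedAddCommGroup F] [InnerProductSpace ℝ F] [FiniteDimensional ℝ F]
    [MeasurableSpace F] [BorelSpace F]
    (h : finrank ℝ E = finrank ℝ F + 1) {w : E} (hw : ‖w‖ = 1) (G : ℝ → ℝ → ℝ≥0∞) :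
    ∫⁻ x : E, G ⟪x, w⟫ ‖x‖ = ∫⁻ p : ℝ × F, G p.1 √(p.1 ^ 2 + ‖p.2‖ ^ 2) := by
  obtain ⟨T, rfl⟩ := exists_linearIsometryEquiv_prod_apply_eq h hw
  have hT : MeasurePreserving (T ∘ WithLp.toLp 2 : ℝ × F → E) :=
    T.measurePreserving.comp (WithLp.volume_preserving_toLp ℝ F)
  rw [← hT.lintegral_comp_emb (T.toHomeomorph.measurableEmbedding.comp
    (MeasurableEquiv.toLp 2 (ℝ × F)).measurableEmbedding)]
  refine lintegral_congr fun p ↦ ?_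
  simp [WithLp.prod_norm_eq_of_L2, WithLp.prod_inner_apply]

/-- Polar coordinates in a half plane. -/
theorem lintegral_half_plane_polar {g : ℝ → ℝ → ℝ≥0∞} :
    ∫⁻ p : ℝ × ℝ, (Ioi 0).indicator (g p.1) p.2 =
      ∫⁻ p in Ioi (0 : ℝ) ×ˢ Ioo 0 π,
        ENNReal.ofReal p.1 * g (p.1 * cos p.2) (p.1 * sin p.2) := by
  rw [← lintegral_comp_polarCoord_symm]
  simp only [polarCoord_target, polarCoord_symm_apply, smul_eq_mul]
  rw [← lintegral_indicator (by measurability), ← lintegral_indicator (by measurability)]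
  refine lintegral_congr fun ⟨r, θ⟩ ↦ ?_
  by_cases hr : 0 < r
  swap
  · simp [hr]
  by_cases hθ : θ ∈ Ioo 0 π
  · have : θ ∈ Ioo (-π) π := ⟨by linarith [hθ.1, pi_pos], hθ.2⟩
    have hs : 0 < r * sin θ := mul_pos hr (sin_pos_of_mem_Ioo hθ)
    rw [indicator_of_mem (mk_mem_prod (mem_Ioi.2 hr) this),
      indicator_of_mem (mk_mem_prod (mem_Ioi.2 hr) hθ), indicator_of_mem (mem_Ioi.2 hs)]
  · rw [indicator_of_notMem (s := Ioi (0 : ℝ) ×ˢ Ioo 0 π) fun h ↦ hθ h.2]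
    refine indicator_apply_eq_zero.2 fun h ↦ ?_
    have h0 : θ ≤ 0 := not_lt.1 fun h0 ↦ hθ ⟨h0, h.2.2⟩
    have : sin θ ≤ 0 := sin_nonpos_of_nonpos_of_neg_pi_le h0 h.2.1.le
    rw [indicator_of_notMem fun h' ↦ ?_, mul_zero]
    exact absurd h' (not_lt.2 (mul_nonpos_of_nonneg_of_nonpos hr.le this))

/-- Integrating a function of the norm times a function of the cosine of the angle to a fixed
direction factors into a radial and an angular integral. -/
theorem exists_lintegral_norm_mul_inner_div_norm {E : Type*}
    [NormedAddCommGroup E] [InnerProductSpace ℝ E] [FiniteDimensional ℝ E]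
    [MeasurableSpace E] [BorelSpace E] {m : ℕ} (hE : finrank ℝ E = m + 2)
    {h : ℝ → ℝ≥0∞} (hh : Measurable h) :
    ∃ K : ℝ≥0∞, ∀ f : ℝ → ℝ≥0∞, Measurable f → ∀ w : E, ‖w‖ = 1 →
      ∫⁻ x : E, h ‖x‖ * f (⟪x, w⟫ / ‖x‖) =
        K * ∫⁻ θ in Ioo 0 π, ENNReal.ofReal (sin θ ^ m) * f (cos θ) := by
  let F := EuclideanSpace ℝ (Fin (m + 1))
  let σ := (volume : Measure F).toSphere univ
  refine ⟨σ * ∫⁻ r in Ioi (0 : ℝ), ENNReal.ofReal (r ^ (m + 1)) * h r, fun f hf w hw ↦ ?_⟩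
  let g : ℝ → ℝ → ℝ≥0∞ := fun x y ↦
    ENNReal.ofReal (y ^ m) * (h √(x ^ 2 + y ^ 2) * f (x / √(x ^ 2 + y ^ 2)))
  have hg : Measurable (Function.uncurry g) := by
    simp only [g, Function.uncurry_def]; fun_prop
  calc
    ∫⁻ x : E, h ‖x‖ * f (⟪x, w⟫ / ‖x‖)
      = ∫⁻ p : ℝ × F, h √(p.1 ^ 2 + ‖p.2‖ ^ 2) * f (p.1 / √(p.1 ^ 2 + ‖p.2‖ ^ 2)) :=
        lintegral_inner_norm_eq_lintegral_prod (by simp [F, hE]) hw fun a b ↦ h b * f (a / b)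
    _ = ∫⁻ x : ℝ, ∫⁻ y : F, h √(x ^ 2 + ‖y‖ ^ 2) * f (x / √(x ^ 2 + ‖y‖ ^ 2)) := by
      rw [Measure.volume_eq_prod, lintegral_prod _ (by fun_prop)]
    _ = ∫⁻ x : ℝ, σ * ∫⁻ y, (Ioi 0).indicator (g x) y := by
      refine lintegral_congr fun x ↦ ?_
      rw [lintegral_indicator measurableSet_Ioi, lintegral_fun_norm_addHaar volume
        (f := fun r ↦ h √(x ^ 2 + r ^ 2) * f (x / √(x ^ 2 + r ^ 2))) (by fun_prop)]
      simp [F, g, σ]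
    _ = σ * ∫⁻ p : ℝ × ℝ, (Ioi 0).indicator (g p.1) p.2 := by
      have hi : Measurable fun p : ℝ × ℝ ↦ (Ioi 0).indicator (g p.1) p.2 :=
        hg.indicator (measurable_snd measurableSet_Ioi)
      rw [Measure.volume_eq_prod, lintegral_prod _ hi.aemeasurable,
        lintegral_const_mul _ hi.lintegral_prod_right']
    _ = σ * ∫⁻ p in Ioi (0 : ℝ) ×ˢ Ioo 0 π, (ENNReal.ofReal (p.1 ^ (m + 1)) * h p.1) *
          (ENNReal.ofReal (sin p.2 ^ m) * f (cos p.2)) := by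
      rw [lintegral_half_plane_polar]
      congr 1
      refine setLIntegral_congr_fun (by measurability) fun ⟨r, θ⟩ ⟨hr, hθ⟩ ↦ ?_
      have hr : 0 < r := hr
      have hn : √((r * cos θ) ^ 2 + (r * sin θ) ^ 2) = r := by
        rw [show (r * cos θ) ^ 2 + (r * sin θ) ^ 2 = r ^ 2 by
          linear_combination r ^ 2 * sin_sq_add_cos_sq θ, sqrt_sq hr.le]
      simp only [g, hn, mul_div_cancel_left₀ _ hr.ne']
      rw [mul_pow, ENNReal.ofReal_mul (by positivity), pow_succ,
        ENNReal.ofReal_mul (by positivity)]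
      ring
    _ = _ := by
      rw [Measure.volume_eq_prod, ← Measure.prod_restrict,
        lintegral_prod_mul (f := fun r ↦ ENNReal.ofReal (r ^ (m + 1)) * h r)
          (g := fun θ ↦ ENNReal.ofReal (sin θ ^ m) * f (cos θ)) (by fun_prop) (by fun_prop),
        mul_assoc]

/-- Integration against the image of a symmetric Beta distribution under `x ↦ 2 * x - 1`, in the
coordinate `θ` with `cos θ = 2 * x - 1`. -/
theorem lintegral_betaMeasure_symm (m : ℕ) {f : ℝ → ℝ≥0∞} (hf : Measurable f) :
    ∫⁻ x, f (2 * x - 1) ∂(betaMeasure ((m + 1) / 2) ((m + 1) / 2)) =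
      ENNReal.ofReal (Gamma ((m + 1) / 2 + (m + 1) / 2) /
        (Gamma ((m + 1) / 2) * Gamma ((m + 1) / 2)) * (1 / 2) ^ m) *
        ∫⁻ θ in Ioo 0 π, ENNReal.ofReal (sin θ ^ m) * f (cos θ) := by
  set a : ℝ := (m + 1) / 2 with ha
  set c := Gamma (a + a) / (Gamma a * Gamma a) with hc
  have ha0 : 0 < a := by positivity
  have hc0 : 0 ≤ c := by
    have := Gamma_pos_of_pos ha0
    have := Gamma_pos_of_pos (add_pos ha0 ha0)
    positivity
  have hm : Measurable (betaPDFReal a a) :=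
    Measurable.ite measurableSet_Ioo (by fun_prop) (by fun_prop)
  have him : (fun θ ↦ (1 + cos θ) / 2) '' Ioo 0 π = Ioo 0 1 := by
    ext x
    constructor
    · rintro ⟨θ, hθ, rfl⟩
      have := mapsTo_cos_Ioo hθ
      constructor <;> linarith [this.1, this.2]
    · intro hx
      refine ⟨arccos (2 * x - 1), ⟨arccos_pos.2 (by linarith [hx.2]), ?_⟩, ?_⟩
      · exact (arccos_le_pi _).lt_of_ne fun h ↦ by
          linarith [arccos_eq_pi.1 h, hx.1]
      · simp only
        rw [cos_arccos (by linarith [hx.1]) (by linarith [hx.2])]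
        ring
  have hinj : InjOn (fun θ ↦ (1 + cos θ) / 2) (Ioo 0 π) := fun x hx y hy hxy ↦
    injOn_cos (Ioo_subset_Icc_self hx) (Ioo_subset_Icc_self hy) (by simp only at hxy; linarith)
  have hd (θ : ℝ) (_ : θ ∈ Ioo 0 π) :
      HasDerivWithinAt (fun θ ↦ (1 + cos θ) / 2) (-sin θ / 2) (Ioo 0 π) θ :=
    (((hasDerivAt_cos θ).const_add 1).div_const 2).hasDerivWithinAt
  calc
    ∫⁻ x, f (2 * x - 1) ∂(betaMeasure a a)
      = ∫⁻ x, ENNReal.ofReal (betaPDFReal a a x) * f (2 * x - 1) := by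
        rw [betaMeasure, lintegral_withDensity_eq_lintegral_mul _ (by fun_prop) (by fun_prop)]
        rfl
    _ = ∫⁻ x in (fun θ ↦ (1 + cos θ) / 2) '' Ioo 0 π,
          ENNReal.ofReal (betaPDFReal a a x) * f (2 * x - 1) := by
      rw [him, ← lintegral_indicator measurableSet_Ioo]
      refine lintegral_congr fun x ↦ ?_
      by_cases hx : x ∈ Ioo (0 : ℝ) 1
      · rw [indicator_of_mem hx]
      · rw [indicator_of_notMem hx, betaPDFReal, if_neg (by exact hx), ENNReal.ofReal_zero, zero_mul]
    _ = ∫⁻ θ in Ioo 0 π, ENNReal.ofReal (c * (1 / 2) ^ m) *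
          (ENNReal.ofReal (sin θ ^ m) * f (cos θ)) := by
      rw [lintegral_image_eq_lintegral_abs_deriv_mul measurableSet_Ioo hd hinj]
      refine setLIntegral_congr_fun measurableSet_Ioo fun θ hθ ↦ ?_
      have hs : 0 < sin θ := sin_pos_of_mem_Ioo hθ
      have hx : (1 + cos θ) / 2 ∈ Ioo (0 : ℝ) 1 := him ▸ mem_image_of_mem _ hθ
      rw [show 2 * ((1 + cos θ) / 2) - 1 = cos θ by ring, ← mul_assoc, ← mul_assoc,
        ← ENNReal.ofReal_mul (abs_nonneg _), ← ENNReal.ofReal_mul (by positivity)]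
      congr 2
      have hsq : (1 + cos θ) / 2 * (1 - (1 + cos θ) / 2) = (sin θ / 2) ^ (2 : ℝ) := by
        rw [rpow_two]
        linear_combination -(1 / 4) * sin_sq_add_cos_sq θ
      rw [betaPDFReal, if_pos (by exact hx), ← hc, mul_assoc c,
        ← mul_rpow hx.1.le (by linarith [hx.2]), hsq, ← rpow_mul (by positivity),
        show 2 * (a - 1) = m - 1 by rw [ha]; ring, rpow_sub_one (by positivity), rpow_natCast,
        neg_div, abs_neg, abs_of_pos (by positivity), div_pow, one_div_pow]
      field_simp
    _ = _ := lintegral_const_mul _ (by fun_prop)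

/-- Under a rotation-invariant measure all unit directions have the same marginal. -/
theorem lintegral_inner_eq_of_rotation_invariant {E : Type*}
    [NormedAddCommGroup E] [InnerProductSpace ℝ E] [MeasurableSpace E] [BorelSpace E]
    {ν : Measure E} (hν : ∀ O : E ≃ₗᵢ[ℝ] E, ν.map O = ν) {u w : E} (h : ‖u‖ = ‖w‖)
    (f : ℝ → ℝ≥0∞) : ∫⁻ y, f ⟪u, y⟫ ∂ν = ∫⁻ y, f ⟪w, y⟫ ∂ν := by
  let O := (ℝ ∙ (u - w))ᗮ.reflection
  have hO : O u = w := Submodule.reflection_sub h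
  conv_rhs => rw [← hν O, ← hO]
  exact ((O.toHomeomorph.measurableEmbedding.lintegral_map _).trans (by simp [O])).symm

/-- The marginal of a rotation-invariant probability measure on the unit sphere. -/
theorem exists_lintegral_inner_sphere {E : Type*}
    [NormedAddCommGroup E] [InnerProductSpace ℝ E] [FiniteDimensional ℝ E]
    [MeasurableSpace E] [BorelSpace E] {m : ℕ} (hE : finrank ℝ E = m + 2)
    {ν : Measure E} [IsProbabilityMeasure ν] (hs : ν (sphere 0 1) = 1)
    (hν : ∀ O : E ≃ₗᵢ[ℝ] E, ν.map O = ν) {u : E} (hu : ‖u‖ = 1) :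
    ∃ C : ℝ≥0∞, ∀ f : ℝ → ℝ≥0∞, Measurable f →
      ∫⁻ y, f ⟪u, y⟫ ∂ν = C * ∫⁻ θ in Ioo 0 π, ENNReal.ofReal (sin θ ^ m) * f (cos θ) := by
  have : Nontrivial E := nontrivial_of_finrank_pos (R := ℝ) (by lia)
  let h : ℝ → ℝ≥0∞ := (Iio 1).indicator 1
  have hh : Measurable h := measurable_one.indicator measurableSet_Iio
  have hball : ∫⁻ x : E, h ‖x‖ = volume (ball (0 : E) 1) := by
    rw [← lintegral_indicator_one measurableSet_ball]
    refine lintegral_congr fun x ↦ ?_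
    simp [h, indicator]
  have hV0 : volume (ball (0 : E) 1) ≠ 0 := (measure_ball_pos _ _ one_pos).ne'
  have hV : volume (ball (0 : E) 1) ≠ ∞ := measure_ball_lt_top.ne
  obtain ⟨K, hK⟩ := exists_lintegral_norm_mul_inner_div_norm hE hh
  refine ⟨(volume (ball (0 : E) 1))⁻¹ * K, fun f hf ↦ ?_⟩
  have hF : Measurable fun p : E × E ↦ h ‖p.1‖ * f (⟪p.1, p.2⟫ / ‖p.1‖) := by fun_prop
  have hsphere : ∀ᵐ y ∂ν, ‖y‖ = 1 := by
    filter_upwards [(prob_compl_eq_zero_iff isClosed_sphere.measurableSet).2 hs |>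
      measure_eq_zero_iff_ae_notMem.1] with y hy
    simpa using hy
  have key : (∫⁻ y, f ⟪u, y⟫ ∂ν) * volume (ball (0 : E) 1) =
      K * ∫⁻ θ in Ioo 0 π, ENNReal.ofReal (sin θ ^ m) * f (cos θ) := by
    calc
      (∫⁻ y, f ⟪u, y⟫ ∂ν) * volume (ball (0 : E) 1)
        = ∫⁻ x : E, h ‖x‖ * ∫⁻ y, f ⟪u, y⟫ ∂ν := by
          rw [lintegral_mul_const _ (by fun_prop), hball, mul_comm]
      _ = ∫⁻ x : E, ∫⁻ y, h ‖x‖ * f (⟪x, y⟫ / ‖x‖) ∂ν := by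
        refine lintegral_congr_ae ?_
        filter_upwards [compl_mem_ae_iff.2 (measure_singleton (0 : E))] with x hx
        have hx : ‖x‖ ≠ 0 := norm_ne_zero_iff.2 hx
        rw [lintegral_const_mul _ (by fun_prop),
          lintegral_inner_eq_of_rotation_invariant hν (w := ‖x‖⁻¹ • x) (by simp [norm_smul, hx, hu])]
        simp only [real_inner_smul_left, div_eq_inv_mul]
      _ = ∫⁻ y, (∫⁻ x : E, h ‖x‖ * f (⟪x, y⟫ / ‖x‖)) ∂ν :=
        lintegral_lintegral_swap (f := fun x y ↦ h ‖x‖ * f (⟪x, y⟫ / ‖x‖)) hF.aemeasurable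
      _ = ∫⁻ _, (K * ∫⁻ θ in Ioo 0 π, ENNReal.ofReal (sin θ ^ m) * f (cos θ)) ∂ν :=
        lintegral_congr_ae (hsphere.mono fun y hy ↦ hK f hf y hy)
      _ = _ := by simp
  rw [mul_assoc, ← key, mul_comm, mul_assoc, ENNReal.mul_inv_cancel hV0 hV, mul_one]

end

/-- If `v` is uniformly distributed on the unit sphere `S^{n-1} ⊂ ℝⁿ` (i.e. its law
is the rotation-invariant probability measure supported on the unit sphere) and
`u` is a fixed unit vector, then `⟨u, v⟩` is distributed as
`2·Beta((n-1)/2, (n-1)/2) - 1`. -/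
theorem inner_uniform_sphere_beta
    (n : ℕ) (hn : 2 ≤ n)
    {Ω : Type*} [MeasurableSpace Ω] (μ : Measure Ω) [IsProbabilityMeasure μ]
    (u : EuclideanSpace ℝ (Fin n)) (hu : ‖u‖ = 1)
    (v : Ω → EuclideanSpace ℝ (Fin n)) (hv : AEMeasurable v μ)
    (hsphere : (μ.map v) (Metric.sphere (0 : EuclideanSpace ℝ (Fin n)) 1) = 1)
    (hrot : ∀ O : EuclideanSpace ℝ (Fin n) ≃ₗᵢ[ℝ] EuclideanSpace ℝ (Fin n),
      (μ.map v).map O = μ.map v) :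
    μ.map (fun ω => ⟪u, v ω⟫)
      = (betaMeasure ((n - 1 : ℝ) / 2) ((n - 1 : ℝ) / 2)).map (fun x => 2 * x - 1) := by
  obtain ⟨m, rfl⟩ := Nat.exists_eq_add_of_le' hn
  have hprob : IsProbabilityMeasure (μ.map v) := Measure.isProbabilityMeasure_map hv
  obtain ⟨C, hC⟩ := exists_lintegral_inner_sphere (m := m) (by simp) hsphere hrot hu
  have hB := fun f hf ↦ lintegral_betaMeasure_symm m (f := f) hf
  have hparam : ((m + 2 : ℕ) - 1 : ℝ) / 2 = (m + 1) / 2 := by push_cast; ring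
  rw [hparam]
  set B := betaMeasure ((m + 1) / 2) ((m + 1) / 2) with hBdef
  have hB1 : B Set.univ = 1 := by
    have ha : (0 : ℝ) < (m + 1) / 2 := by positivity
    have := ProbabilityTheory.isProbabilityMeasureBeta ha ha
    rw [← measure_univ (μ := ProbabilityTheory.betaMeasure ((m + 1) / 2) ((m + 1) / 2))]
    congr 1
    simp only [hBdef, betaMeasure, ProbabilityTheory.betaMeasure]
    congr with x
    simp [betaPDFReal, ProbabilityTheory.betaPDF, ProbabilityTheory.betaPDFReal,
      ProbabilityTheory.beta]
  have hC1 := hC 1 measurable_one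
  have hc1 := hB 1 measurable_one
  simp only [Pi.one_apply, lintegral_one, measure_univ, hB1] at hC1 hc1
  have hCc := ENNReal.eq_inv_of_mul_eq_one_left hC1.symm
  rw [← ENNReal.eq_inv_of_mul_eq_one_left hc1.symm] at hCc
  refine Measure.ext_of_lintegral _ fun f hf ↦ ?_
  rw [show (fun ω ↦ ⟪u, v ω⟫) = (fun y ↦ ⟪u, y⟫) ∘ v from rfl,
    ← AEMeasurable.map_map_of_aemeasurable (by fun_prop) hv,
    lintegral_map hf (by fun_prop), lintegral_map hf (by fun_prop), hC f hf, hB f hf, hCc]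
end

section
/- Sub-Gaussianity of the uniform distribution on the sphere. Let M ≥ 2 and let z be a random vector with the uniform (normalized surface) distribution on the unit sphere S^{M−1} ⊂ ℝ^M. Then z is √(1/M)-sub-Gaussian: for every fixed unit vector v ∈ S^{M−1} and every λ ∈ ℝ, E[exp(λ⟨v, z⟩)] ≤ exp(λ² / (2M)). -/
open MeasureTheory Real
open scoped RealInnerProductSpace

/-- Tangent-line inequality expressing the convexity of `u ↦ cosh √u`. -/
theorem cosh_add_mul_sinh_le_cosh_mul (a r : ℝ) :
    cosh a + a * sinh a / 2 * (r ^ 2 - 1) ≤ cosh (r * a) := by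
  have hs : HasSum (fun n : ℕ ↦ n * (a ^ (2 * n) / (2 * n).factorial)) (a * sinh a / 2) := by
    rw [← hasSum_nat_add_iff' 1]
    have h0 : a * sinh a / 2 - ∑ i ∈ Finset.range 1, (i : ℝ) * (a ^ (2 * i) / (2 * i).factorial) =
        a / 2 * sinh a := by
      simp
      ring
    rw [h0]
    refine (congrArg (HasSum · _) (funext fun n ↦ ?_)).mpr ((hasSum_sinh a).mul_left (a / 2))
    have h : (2 * (n + 1)).factorial = (2 * (n + 1)) * (2 * n + 1).factorial :=
      Nat.factorial_succ (2 * n + 1)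
    rw [h]
    push_cast
    have := Nat.cast_ne_zero (R := ℝ).2 (2 * n + 1).factorial_ne_zero
    field_simp
    ring
  refine hasSum_le (fun n ↦ ?_) ((hasSum_cosh a).add (hs.mul_right (r ^ 2 - 1)))
    (hasSum_cosh (r * a))
  have hb := one_add_mul_le_pow (a := r ^ 2 - 1) (by nlinarith [sq_nonneg r]) n
  rw [add_sub_cancel, ← pow_mul] at hb
  have hc : 0 ≤ a ^ (2 * n) / (2 * n).factorial := by
    rw [pow_mul]
    positivity
  calc _ = (1 + n * (r ^ 2 - 1)) * (a ^ (2 * n) / (2 * n).factorial) := by ring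
    _ ≤ r ^ (2 * n) * (a ^ (2 * n) / (2 * n).factorial) := by gcongr
    _ = _ := by rw [mul_pow]; ring

namespace ProbabilityTheory

section StdGaussian

variable {E : Type*} [NormedAddCommGroup E] [InnerProductSpace ℝ E] [FiniteDimensional ℝ E]
  [MeasurableSpace E] [BorelSpace E]

theorem mgf_inner_stdGaussian (y : E) (t : ℝ) :
    mgf (fun x ↦ ⟪x, y⟫) (stdGaussian E) t = exp (‖y‖ ^ 2 * t ^ 2 / 2) := by
  have h := IsGaussian.map_eq_gaussianReal (μ := stdGaussian E) (innerSL ℝ y)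
  rw [integral_strongDual_stdGaussian, variance_dual_stdGaussian] at h
  have h' : (fun x ↦ ⟪x, y⟫) = innerSL ℝ y := by
    ext x
    simp [real_inner_comm]
  rw [h', mgf_gaussianReal h]
  simp

theorem integral_inner_sq_stdGaussian (y : E) :
    ∫ x, ⟪y, x⟫ ^ 2 ∂(stdGaussian E) = ‖y‖ ^ 2 := by
  have h := variance_dual_stdGaussian (innerSL ℝ y)
  rw [variance_eq_integral (by fun_prop), integral_strongDual_stdGaussian] at h
  simpa using h

theorem integrable_norm_sq_stdGaussian : Integrable (fun x : E ↦ ‖x‖ ^ 2) (stdGaussian E) :=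
  (IsGaussian.memLp_two_id (μ := stdGaussian E)).norm.integrable_sq

theorem integral_norm_sq_stdGaussian :
    ∫ x, ‖x‖ ^ 2 ∂(stdGaussian E) = Module.finrank ℝ E := by
  simp_rw [← (stdOrthonormalBasis ℝ E).sum_sq_inner_right]
  rw [integral_finsetSum]
  · simp [integral_inner_sq_stdGaussian]
  · intro i _
    exact ((IsGaussian.memLp_two_id (μ := stdGaussian E)).const_inner _).integrable_sq

end StdGaussian

end ProbabilityTheory

section Sphere

variable {E : Type*} [NormedAddCommGroup E] [InnerProductSpace ℝ E] [MeasurableSpace E]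
  [BorelSpace E] {ν : Measure E}

theorem Continuous.integrable_inner_of_ae_norm_eq_one [IsFiniteMeasure ν]
    (hν : ∀ᵐ z ∂ν, ‖z‖ = 1) {f : ℝ → ℝ} (hf : Continuous f) (w : E) :
    Integrable (fun z ↦ f ⟪w, z⟫) ν := by
  obtain ⟨C, hC⟩ := (isCompact_Icc (a := -‖w‖) (b := ‖w‖)).exists_bound_of_continuousOn
    hf.continuousOn
  refine .of_bound (Measurable.aestronglyMeasurable ?_) C ?_
  · exact hf.measurable.comp (by fun_prop)
  · filter_upwards [hν] with z hz
    have h := abs_real_inner_le_norm w z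
    rw [hz, mul_one] at h
    exact hC _ (abs_le.1 h)

theorem integral_exp_inner_eq_integral_cosh [FiniteDimensional ℝ E] [IsFiniteMeasure ν]
    (hν : ∀ᵐ z ∂ν, ‖z‖ = 1) (hrot : ∀ O : E ≃ₗᵢ[ℝ] E, ν.map O = ν) {v : E} (hv : ‖v‖ = 1)
    (w : E) : ∫ z, exp ⟪w, z⟫ ∂ν = ∫ z, cosh (‖w‖ * ⟪v, z⟫) ∂ν := by
  have hinv (w₁ w₂ : E) (h : ‖w₁‖ = ‖w₂‖) : ∫ z, exp ⟪w₁, z⟫ ∂ν = ∫ z, exp ⟪w₂, z⟫ ∂ν := by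
    set O := (ℝ ∙ (w₁ - w₂))ᗮ.reflection with hO
    have hw : O w₁ = w₂ := Submodule.reflection_sub h
    nth_rewrite 2 [← hrot O]
    rw [integral_map (by fun_prop) (by fun_prop), ← hw]
    simp
  have h₁ := hinv w (‖w‖ • v) (by simp [norm_smul, hv])
  have h₂ := hinv w (-‖w‖ • v) (by simp [norm_smul, hv])
  have hint (c : ℝ) : Integrable (fun z ↦ exp (c * ⟪v, z⟫)) ν :=
    Continuous.integrable_inner_of_ae_norm_eq_one hν (f := fun s ↦ exp (c * s)) (by fun_prop) v
  simp_rw [real_inner_smul_left] at h₁ h₂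
  simp_rw [cosh_eq, ← neg_mul]
  rw [integral_div, integral_add (hint _) (hint _)]
  linarith

open ProbabilityTheory in
theorem integral_exp_inner_le_of_ae_norm_eq_one [FiniteDimensional ℝ E] [IsProbabilityMeasure ν]
    (hν : ∀ᵐ z ∂ν, ‖z‖ = 1) (hrot : ∀ O : E ≃ₗᵢ[ℝ] E, ν.map O = ν) {v : E} (hv : ‖v‖ = 1)
    (l : ℝ) :
    ∫ z, exp (l * ⟪v, z⟫) ∂ν ≤ exp (l ^ 2 / (2 * Module.finrank ℝ E)) := by
  obtain ⟨M, hM⟩ : ∃ M : ℝ, M = Module.finrank ℝ E := ⟨_, rfl⟩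
  rw [← hM]
  have : Nontrivial E := ⟨v, 0, fun h ↦ by simp [h] at hv⟩
  have hM0 : 0 < M := by
    rw [hM]
    exact_mod_cast Module.finrank_pos
  set t : ℝ := |l| / √M with ht
  have hφ : ∫ z, exp (l * ⟪v, z⟫) ∂ν = ∫ z, cosh (|l| * ⟪v, z⟫) ∂ν := by
    simpa [real_inner_smul_left, norm_smul, hv] using
      integral_exp_inner_eq_integral_cosh hν hrot hv (l • v)
  set K : ℝ := ∫ z, |l| * ⟪v, z⟫ * sinh (|l| * ⟪v, z⟫) / 2 ∂ν with hK
  have hlower (x : E) : ∫ z, cosh (|l| * ⟪v, z⟫) ∂ν + K * (‖x‖ ^ 2 / M - 1) ≤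
      ∫ z, exp (t * ⟪x, z⟫) ∂ν := by
    have h := integral_exp_inner_eq_integral_cosh hν hrot hv (t • x)
    simp_rw [real_inner_smul_left] at h
    have hint {f : ℝ → ℝ} (hf : Continuous f) : Integrable (fun z ↦ f ⟪v, z⟫) ν :=
      hf.integrable_inner_of_ae_norm_eq_one hν v
    have hi₁ : Integrable (fun z ↦ cosh (|l| * ⟪v, z⟫)) ν :=
      hint (f := fun s ↦ cosh (|l| * s)) (by fun_prop)
    have hi₂ : Integrable
        (fun z ↦ |l| * ⟪v, z⟫ * sinh (|l| * ⟪v, z⟫) / 2 * (‖x‖ ^ 2 / M - 1)) ν :=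
      hint (f := fun s ↦ |l| * s * sinh (|l| * s) / 2 * (‖x‖ ^ 2 / M - 1)) (by fun_prop)
    rw [h, hK, ← integral_mul_const, ← integral_add hi₁ hi₂]
    refine integral_mono (hi₁.add hi₂)
      (hint (f := fun s ↦ cosh (‖t • x‖ * s)) (by fun_prop)) fun z ↦ ?_
    have hc := cosh_add_mul_sinh_le_cosh_mul (|l| * ⟪v, z⟫) (‖x‖ / √M)
    rw [div_pow, Real.sq_sqrt hM0.le] at hc
    have he : ‖t • x‖ * ⟪v, z⟫ = ‖x‖ / √M * (|l| * ⟪v, z⟫) := by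
      rw [norm_smul, Real.norm_of_nonneg (by positivity), ht]
      ring
    simpa only [he] using hc
  have hupper : ∀ᵐ z ∂ν, ∫ x, exp (t * ⟪x, z⟫) ∂(stdGaussian E) = exp (l ^ 2 / (2 * M)) := by
    filter_upwards [hν] with z hz
    have h := mgf_inner_stdGaussian z t
    rw [mgf, hz] at h
    rw [h, ht, div_pow, sq_abs, Real.sq_sqrt hM0.le]
    congr 1
    field_simp
  have hprod : Integrable (fun p : E × E ↦ exp (t * ⟪p.1, p.2⟫)) ((stdGaussian E).prod ν) := by
    rw [integrable_prod_iff' (Continuous.aestronglyMeasurable (by fun_prop))]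
    refine ⟨?_, (integrable_const (exp (l ^ 2 / (2 * M)))).congr ?_⟩
    · filter_upwards with z
      refine mgf_pos_iff.1 ?_
      rw [mgf_inner_stdGaussian]
      positivity
    · filter_upwards [hupper] with z hz
      simp [← hz]
  have hi : Integrable (fun x : E ↦ ‖x‖ ^ 2 / M - 1) (stdGaussian E) :=
    (integrable_norm_sq_stdGaussian.div_const M).sub (integrable_const 1)
  calc ∫ z, exp (l * ⟪v, z⟫) ∂ν
      = ∫ x, (∫ z, cosh (|l| * ⟪v, z⟫) ∂ν + K * (‖x‖ ^ 2 / M - 1)) ∂(stdGaussian E) := by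
        rw [integral_add (integrable_const _) (hi.const_mul K), integral_const_mul,
          integral_sub (integrable_norm_sq_stdGaussian.div_const M) (integrable_const 1),
          integral_div, integral_norm_sq_stdGaussian, hφ]
        simp [← hM, hM0.ne']
    _ ≤ ∫ x, ∫ z, exp (t * ⟪x, z⟫) ∂ν ∂(stdGaussian E) :=
        integral_mono ((integrable_const _).add (hi.const_mul K)) hprod.integral_prod_left hlower
    _ = ∫ z, ∫ x, exp (t * ⟪x, z⟫) ∂(stdGaussian E) ∂ν := integral_integral_swap hprod
    _ = exp (l ^ 2 / (2 * M)) := by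
        rw [integral_congr_ae hupper]
        simp

end Sphere

/-- Sub-Gaussianity of the uniform distribution on the sphere: if `z` is uniformly
distributed on the unit sphere `S^{M-1} ⊂ ℝ^M` (i.e. its law is the
rotation-invariant probability measure supported on the unit sphere), then for
every fixed unit vector `v` and every `λ ∈ ℝ`,
`E[exp(λ ⟨v, z⟩)] ≤ exp(λ² / (2M))`. -/
theorem uniform_sphere_subGaussian
    (M : ℕ) (hM : 2 ≤ M)
    {Ω : Type*} [MeasurableSpace Ω] (μ : Measure Ω) [IsProbabilityMeasure μ]
    (z : Ω → EuclideanSpace ℝ (Fin M)) (hz : AEMeasurable z μ)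
    (hsphere : (μ.map z) (Metric.sphere (0 : EuclideanSpace ℝ (Fin M)) 1) = 1)
    (hrot : ∀ O : EuclideanSpace ℝ (Fin M) ≃ₗᵢ[ℝ] EuclideanSpace ℝ (Fin M),
      (μ.map z).map O = μ.map z) :
    ∀ v : EuclideanSpace ℝ (Fin M), ‖v‖ = 1 → ∀ l : ℝ,
      ∫ ω, Real.exp (l * ⟪v, z ω⟫) ∂μ ≤ Real.exp (l ^ 2 / (2 * M)) := by
  intro v hv l
  have : IsProbabilityMeasure (μ.map z) := Measure.isProbabilityMeasure_map hz
  have hν : ∀ᵐ x ∂(μ.map z), ‖x‖ = 1 := by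
    filter_upwards [(mem_ae_iff_prob_eq_one Metric.isClosed_sphere.measurableSet).2 hsphere]
      with x hx
    simpa using hx
  have h := integral_exp_inner_le_of_ae_norm_eq_one hν hrot hv l
  rwa [finrank_euclideanSpace_fin, integral_map hz (by fun_prop)] at h
end
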